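/- For every positive integer n, the number of compositions (c_1,…,c_t) of n satisfying c_{2i-1} > c_{2i} for every index i with 2i ≤ t equals the number of compositions of n all of whose parts are odd. -/

import Mathlib

/-- A composition of `n`: a list of positive integers summing to `n`. -/
def IsComposition (n : ℕ) (l : List ℕ) : Prop :=
  (∀ x ∈ l, 0 < x) ∧ l.sum = n

/-- Arndt condition: `c_{2i-1} > c_{2i}` for every pair of consecutive parts. -/
def ArndtCond (l : List ℕ) : Prop :=
  ∀ i : ℕ, 2 * i + 1 < l.length → l.getD (2 * i + 1) 0 < l.getD (2 * i) 0

theorem arndtCond_nil : ArndtCond [] := by simp [ArndtCond]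

theorem arndtCond_singleton (a : ℕ) : ArndtCond [a] := by simp [ArndtCond]

theorem arndtCond_cons_cons {a b : ℕ} {l : List ℕ} :
    ArndtCond (a :: b :: l) ↔ b < a ∧ ArndtCond l := by
  refine ⟨fun h ↦ ⟨by simpa using h 0, fun i hi ↦ ?_⟩, fun ⟨hab, h⟩ i hi ↦ ?_⟩
  · simpa [Nat.mul_add] using h (i + 1) (by simp only [List.length_cons]; omega)
  · cases i with
    | zero => simpa using hab
    | succ i =>
      simpa [Nat.mul_add] using h i (by simp only [List.length_cons] at hi; omega)

theorem isComposition_nil {n : ℕ} : IsComposition n [] ↔ n = 0 := by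
  simp [IsComposition, eq_comm]

theorem isComposition_cons {n a : ℕ} {l : List ℕ} :
    IsComposition n (a :: l) ↔ 0 < a ∧ a ≤ n ∧ IsComposition (n - a) l := by
  simp only [IsComposition, List.mem_cons, forall_eq_or_imp, List.sum_cons]
  constructor
  · rintro ⟨⟨h, h'⟩, hs⟩
    exact ⟨h, by omega, h', by omega⟩
  · rintro ⟨h, h', h'', hs⟩
    exact ⟨⟨h, h''⟩, by omega⟩

/-- The compositions of `n` satisfying `P`. -/
def compositionsWith (P : List ℕ → Prop) (n : ℕ) : Set (List ℕ) :=
  {l | IsComposition n l ∧ P l}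

theorem finite_compositionsWith (P : List ℕ → Prop) (n : ℕ) : (compositionsWith P n).Finite := by
  refine (Set.finite_range (fun c : Composition n ↦ c.blocks)).subset ?_
  rintro l ⟨⟨hpos, hsum⟩, -⟩
  exact ⟨⟨l, fun {i} hi ↦ hpos i hi, hsum⟩, rfl⟩

/-- Two injections with complementary disjoint images give an additive recurrence. -/
theorem ncard_compositionsWith_eq_add {P : List ℕ → Prop} {m k n : ℕ} (f g : List ℕ → List ℕ)
    (hf : Set.MapsTo f (compositionsWith P m) (compositionsWith P n))
    (hg : Set.MapsTo g (compositionsWith P k) (compositionsWith P n))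
    (hfi : Set.InjOn f (compositionsWith P m)) (hgi : Set.InjOn g (compositionsWith P k))
    (hfg : ∀ l ∈ compositionsWith P m, ∀ l' ∈ compositionsWith P k, f l ≠ g l')
    (hsurj : ∀ l ∈ compositionsWith P n,
      (∃ l' ∈ compositionsWith P m, f l' = l) ∨ ∃ l' ∈ compositionsWith P k, g l' = l) :
    (compositionsWith P n).ncard =
      (compositionsWith P m).ncard + (compositionsWith P k).ncard := by
  have hunion : compositionsWith P n = f '' compositionsWith P m ∪ g '' compositionsWith P k :=
    Set.Subset.antisymm hsurj (Set.union_subset hf.image_subset hg.image_subset)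
  have hdisj : Disjoint (f '' compositionsWith P m) (g '' compositionsWith P k) := by
    rw [Set.disjoint_left]
    rintro _ ⟨l, hl, rfl⟩ ⟨l', hl', h⟩
    exact hfg l hl l' hl' h.symm
  rw [hunion, Set.ncard_union_eq hdisj ((finite_compositionsWith P m).image f)
    ((finite_compositionsWith P k).image g), hfi.ncard_image,
    hgi.ncard_image]

/-- The condition that all parts are odd. -/
def AllOdd (l : List ℕ) : Prop := ∀ x ∈ l, Odd x

theorem allOdd_nil : AllOdd [] := by simp [AllOdd]

theorem allOdd_cons {a : ℕ} {l : List ℕ} : AllOdd (a :: l) ↔ a % 2 = 1 ∧ AllOdd l := by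
  simp [AllOdd, Nat.odd_iff]

/-- Increase the first part of a list by `k`. -/
def addHead (k : ℕ) : List ℕ → List ℕ
  | [] => []
  | a :: l => (a + k) :: l

/-- Injection from nonempty Arndt compositions of `n` onto the Arndt compositions of `n + 2`
whose first two parts are consecutive integers. -/
def arndtAddTwo : List ℕ → List ℕ
  | [] => []
  | [a] => if a = 1 then [2, 1] else [2, 1, a - 1]
  | a :: b :: l => if a = b + 1 then (a + 1) :: (b + 1) :: l else 2 :: 1 :: (a - 1) :: b :: l

theorem mem_compositionsWith_arndt_nil {n : ℕ} : [] ∈ compositionsWith ArndtCond n ↔ n = 0 := by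
  simp [compositionsWith, isComposition_nil, arndtCond_nil]

theorem mem_compositionsWith_arndt_singleton {n a : ℕ} :
    [a] ∈ compositionsWith ArndtCond n ↔ 0 < a ∧ a = n := by
  simp only [compositionsWith, Set.mem_ofPred_eq, isComposition_cons, isComposition_nil,
    arndtCond_singleton, and_true]
  omega

theorem mem_compositionsWith_arndt_cons_cons {n a b : ℕ} {l : List ℕ} :
    a :: b :: l ∈ compositionsWith ArndtCond n ↔
      0 < b ∧ b < a ∧ a + b ≤ n ∧ l ∈ compositionsWith ArndtCond (n - (a + b)) := by
  simp only [compositionsWith, Set.mem_ofPred_eq, isComposition_cons, arndtCond_cons_cons,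
    Nat.sub_sub]
  constructor
  · rintro ⟨⟨_, _, _, _, h⟩, _, h'⟩
    exact ⟨by omega, by omega, by omega, h, h'⟩
  · rintro ⟨_, _, _, h, h'⟩
    exact ⟨⟨by omega, by omega, by omega, by omega, h⟩, by omega, h'⟩

theorem mem_compositionsWith_allOdd_nil {n : ℕ} : [] ∈ compositionsWith AllOdd n ↔ n = 0 := by
  simp [compositionsWith, isComposition_nil, allOdd_nil]

theorem mem_compositionsWith_allOdd_cons {n a : ℕ} {l : List ℕ} :
    a :: l ∈ compositionsWith AllOdd n ↔
      a % 2 = 1 ∧ a ≤ n ∧ l ∈ compositionsWith AllOdd (n - a) := by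
  simp only [compositionsWith, Set.mem_ofPred_eq, isComposition_cons, allOdd_cons]
  constructor
  · rintro ⟨⟨_, _, h⟩, _, h'⟩
    exact ⟨by omega, by omega, h, h'⟩
  · rintro ⟨_, _, h, h'⟩
    exact ⟨⟨by omega, by omega, h⟩, by omega, h'⟩

theorem ncard_allOdd_add_two {n : ℕ} (hn : 0 < n) :
    (compositionsWith AllOdd (n + 2)).ncard =
      (compositionsWith AllOdd (n + 1)).ncard + (compositionsWith AllOdd n).ncard := by
  apply ncard_compositionsWith_eq_add (List.cons 1) (addHead 2)
  · intro l hl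
    simpa [mem_compositionsWith_allOdd_cons] using hl
  · rintro (_ | ⟨a, l⟩) hl
    · grind [mem_compositionsWith_allOdd_nil]
    · grind [addHead, mem_compositionsWith_allOdd_cons]
  · exact fun _ _ _ _ h ↦ List.tail_eq_of_cons_eq h
  · rintro (_ | ⟨a, l⟩) hl (_ | ⟨b, m⟩) hm <;>
      grind [addHead, mem_compositionsWith_allOdd_nil]
  · rintro l - (_ | ⟨b, m⟩) hm <;>
      grind [addHead, mem_compositionsWith_allOdd_nil, mem_compositionsWith_allOdd_cons]
  · rintro (_ | ⟨a, l⟩) hl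
    · grind [mem_compositionsWith_allOdd_nil]
    · rw [mem_compositionsWith_allOdd_cons] at hl
      obtain rfl | ha := eq_or_ne a 1
      · exact .inl ⟨l, by simpa using hl.2.2, rfl⟩
      · refine .inr ⟨(a - 2) :: l, ?_, by grind [addHead]⟩
        grind [mem_compositionsWith_allOdd_cons]

theorem ncard_arndt_add_two {n : ℕ} (hn : 0 < n) :
    (compositionsWith ArndtCond (n + 2)).ncard =
      (compositionsWith ArndtCond (n + 1)).ncard + (compositionsWith ArndtCond n).ncard := by
  apply ncard_compositionsWith_eq_add (addHead 1) arndtAddTwo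
  · rintro (_ | ⟨a, _ | ⟨b, l⟩⟩) hl <;>
      grind [addHead, mem_compositionsWith_arndt_nil, mem_compositionsWith_arndt_singleton,
        mem_compositionsWith_arndt_cons_cons]
  · rintro (_ | ⟨a, _ | ⟨b, l⟩⟩) hl <;>
      grind [arndtAddTwo, mem_compositionsWith_arndt_nil, mem_compositionsWith_arndt_singleton,
        mem_compositionsWith_arndt_cons_cons]
  · rintro (_ | ⟨a, l⟩) hl (_ | ⟨b, m⟩) hm <;> grind [addHead]
  · rintro (_ | ⟨a, _ | ⟨b, l⟩⟩) hl (_ | ⟨c, _ | ⟨d, m⟩⟩) hm <;>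
      grind [arndtAddTwo, mem_compositionsWith_arndt_nil, mem_compositionsWith_arndt_singleton,
        mem_compositionsWith_arndt_cons_cons]
  · rintro (_ | ⟨a, _ | ⟨b, l⟩⟩) hl (_ | ⟨c, _ | ⟨d, m⟩⟩) hm <;>
      grind [addHead, arndtAddTwo, mem_compositionsWith_arndt_nil,
        mem_compositionsWith_arndt_singleton, mem_compositionsWith_arndt_cons_cons]
  · rintro (_ | ⟨a, _ | ⟨b, l⟩⟩) hl
    · grind [mem_compositionsWith_arndt_nil]
    · refine .inl ⟨[a - 1], ?_, ?_⟩ <;> grind [addHead, mem_compositionsWith_arndt_singleton]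
    · obtain ⟨hb, hba, hn', hl⟩ := mem_compositionsWith_arndt_cons_cons.1 hl
      obtain rfl | hab := eq_or_ne a (b + 1)
      · right
        obtain rfl | hb1 := eq_or_ne b 1
        · obtain _ | ⟨c, _ | ⟨d, l⟩⟩ := l
          · refine ⟨[1], ?_, ?_⟩ <;> grind [arndtAddTwo, mem_compositionsWith_arndt_nil,
              mem_compositionsWith_arndt_singleton]
          · refine ⟨[c + 1], ?_, ?_⟩ <;> grind [arndtAddTwo, mem_compositionsWith_arndt_singleton]
          · refine ⟨(c + 1) :: d :: l, ?_, ?_⟩ <;>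
              grind [arndtAddTwo, mem_compositionsWith_arndt_cons_cons]
        · refine ⟨b :: (b - 1) :: l, ?_, ?_⟩ <;>
            grind [arndtAddTwo, mem_compositionsWith_arndt_cons_cons]
      · refine .inl ⟨(a - 1) :: b :: l, ?_, ?_⟩ <;>
          grind [addHead, mem_compositionsWith_arndt_cons_cons]

theorem compositionsWith_arndt_eq_singleton {n : ℕ} (hn : 0 < n) (hn' : n ≤ 2) :
    compositionsWith ArndtCond n = {[n]} := by
  ext (_ | ⟨a, _ | ⟨b, l⟩⟩) <;>
    grind [mem_compositionsWith_arndt_nil, mem_compositionsWith_arndt_singleton,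
      mem_compositionsWith_arndt_cons_cons]

theorem compositionsWith_allOdd_eq_singleton {n : ℕ} (hn' : n ≤ 2) :
    compositionsWith AllOdd n = {List.replicate n 1} := by
  interval_cases n <;> ext (_ | ⟨a, _ | ⟨b, _ | ⟨c, l⟩⟩⟩) <;>
    grind [mem_compositionsWith_allOdd_nil, mem_compositionsWith_allOdd_cons]

theorem ncard_arndt_eq_ncard_allOdd (n : ℕ) (hn : 0 < n) :
    (compositionsWith ArndtCond n).ncard = (compositionsWith AllOdd n).ncard := by
  induction n using Nat.strong_induction_on with
  | _ n ih =>
    obtain hn' | hn' := le_or_gt n 2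
    · rw [compositionsWith_arndt_eq_singleton hn hn', compositionsWith_allOdd_eq_singleton hn',
        Set.ncard_singleton, Set.ncard_singleton]
    · obtain ⟨m, rfl⟩ := Nat.exists_eq_add_of_lt hn'
      rw [show 2 + m + 1 = (m + 1) + 2 by omega, ncard_arndt_add_two m.succ_pos,
        ncard_allOdd_add_two m.succ_pos, ih _ (by omega) (by omega), ih _ (by omega) (by omega)]

theorem arndt_count_eq_odd_count (n : ℕ) (hn : 0 < n) :
    Nat.card {l : List ℕ // IsComposition n l ∧ ArndtCond l} =
      Nat.card {l : List ℕ // IsComposition n l ∧ ∀ x ∈ l, Odd x} :=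
  ncard_arndt_eq_ncard_allOdd n hn
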